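/- For each integer s ≥ 1 define F_s : ℝ → ℝ by F_s(c) = d_TV(η^s_{c − ln √s}, ν_s). If r and s are positive integers and a > 0, b ∈ ℝ are such that F_r(ac + b) = F_s(c) for every c ∈ ℝ, then a = 1, b = 0, and r = s. -/

import Mathlib

open MeasureTheory Polynomial Filter

/-- The orthogonal polynomials `Q_n^s`: `Q_0 = 1`, `Q_1 = X`,
`X * Q_n = Q_{n+1} + √s * Q_n + Q_{n-1}`. -/
noncomputable def Qpoly (s : ℕ) : ℕ → Polynomial ℝ
  | 0 => 1
  | 1 => Polynomial.X
  | (n + 2) => Polynomial.X * Qpoly s (n + 1)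
      - Polynomial.C (Real.sqrt s) * Qpoly s (n + 1) - Qpoly s n

/-- Chebyshev polynomials of the second kind: `P_0 = 1`, `P_1 = X`,
`X * P_n = P_{n+1} + P_{n-1}`. -/
noncomputable def Ppoly : ℕ → Polynomial ℝ
  | 0 => 1
  | 1 => Polynomial.X
  | (n + 2) => Polynomial.X * Ppoly (n + 1) - Ppoly n

/-- The density of the absolutely continuous part of `ν_s`. -/
noncomputable def nuDensity (s : ℕ) (x : ℝ) : ℝ :=
  Real.sqrt (4 - (x - Real.sqrt s) ^ 2) / (2 * Real.pi * (x * Real.sqrt s + 1))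

/-- The free Meixner measure `ν_s`. -/
noncomputable def nuMeas (s : ℕ) : Measure ℝ :=
  volume.withDensity (fun x => ENNReal.ofReal
      (if |x - Real.sqrt s| ≤ 2 then nuDensity s x else 0))
    + ENNReal.ofReal (1 - 1 / (s : ℝ)) • Measure.dirac (-1 / Real.sqrt s)

/-- The density `f_c`. -/
noncomputable def fc (s : ℕ) (c x : ℝ) : ℝ :=
  (Real.exp c + Real.sqrt s) / (Real.exp c + Real.exp (-c) + Real.sqrt s - x)

/-- The measure `η_c^s = f_c · ν_s + 1_{c<0} ((e^{-c}-e^c)/(e^{-c}+√s)) δ_{e^c+√s+e^{-c}}`. -/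
noncomputable def etaMeas (s : ℕ) (c : ℝ) : Measure ℝ :=
  (nuMeas s).withDensity (fun x => ENNReal.ofReal (fc s c x))
    + (if c < 0 then
        ENNReal.ofReal ((Real.exp (-c) - Real.exp c) / (Real.exp (-c) + Real.sqrt s))
      else 0) • Measure.dirac (Real.exp c + Real.sqrt s + Real.exp (-c))

/-- Total variation distance between two Borel measures on `ℝ`. -/
noncomputable def dTV (μ ν : Measure ℝ) : ℝ :=
  ⨆ A : {A : Set ℝ // MeasurableSet A}, |(μ A.1).toReal - (ν A.1).toReal|

/-- The integral of the Poisson kernel over a half period. -/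
theorem integral_poissonKernel {q : ℝ} (hq : 1 < q) :
    ∫ θ in (0 : ℝ)..Real.pi, (q ^ 2 - 1) / (q ^ 2 - 2 * q * Real.cos θ + 1) = Real.pi := by
  have hden (θ : ℝ) : 0 < q - Real.cos θ := by linarith [Real.cos_le_one θ]
  have hden' (θ : ℝ) : 0 < q ^ 2 - 2 * q * Real.cos θ + 1 := by
    nlinarith [hden θ, Real.sin_sq_add_cos_sq θ, sq_nonneg (Real.sin θ), pow_pos (hden θ) 2]
  have hd (θ : ℝ) : HasDerivAt
      (fun θ => θ + 2 * Real.arctan (Real.sin θ / (q - Real.cos θ)))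
      ((q ^ 2 - 1) / (q ^ 2 - 2 * q * Real.cos θ + 1)) θ := by
    have h1 := ((Real.hasDerivAt_sin θ).div ((Real.hasDerivAt_cos θ).const_sub q)
      (hden θ).ne').arctan.const_mul 2
    refine ((hasDerivAt_id θ).add h1).congr_deriv ?_
    have e : 1 + (Real.sin θ / (q - Real.cos θ)) ^ 2
        = (q ^ 2 - 2 * q * Real.cos θ + 1) / (q - Real.cos θ) ^ 2 := by
      have := (hden θ).ne'
      field_simp
      linear_combination Real.sin_sq_add_cos_sq θ
    simp only [Pi.div_apply, e]
    have h2 := (hden θ).ne'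
    have h3 := (hden' θ).ne'
    generalize hD : q ^ 2 - 2 * q * Real.cos θ + 1 = D at *
    field_simp
    linear_combination (-2) * Real.sin_sq_add_cos_sq θ - hD
  rw [intervalIntegral.integral_eq_sub_of_hasDerivAt (fun θ _ => hd θ)]
  · simp
  · apply Continuous.intervalIntegrable
    exact continuous_const.div (by fun_prop) fun θ => (hden' θ).ne'

/-- The unnormalised semicircle density times the Cauchy kernel at `q + q⁻¹`. -/
noncomputable def semicircleCauchy (q w : ℝ) : ℝ :=
  Real.sqrt (4 - w ^ 2) / (q + q⁻¹ - w)

theorem sqrt_four_sub_sq_eq_zero {w : ℝ} (hw : w ∉ Set.Ioo (-2 : ℝ) 2) :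
    Real.sqrt (4 - w ^ 2) = 0 := by
  apply Real.sqrt_eq_zero_of_nonpos
  by_contra! h
  exact hw ⟨by nlinarith, by nlinarith⟩

theorem two_le_add_inv {q : ℝ} (hq : 1 ≤ q) : 2 ≤ q + q⁻¹ := by
  have h0 : 0 < q := by linarith
  have : q * q⁻¹ = 1 := mul_inv_cancel₀ h0.ne'
  nlinarith [sq_nonneg (q - 1), inv_pos.2 h0]

theorem semicircleCauchy_subst {q θ : ℝ} (hq : 1 ≤ q) (hθ : θ ∈ Set.Ioo 0 Real.pi) :
    |(-(2 * Real.sin θ))| • semicircleCauchy q (2 * Real.cos θ) =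
      (q + q⁻¹ + 2 * Real.cos θ) -
        (q - q⁻¹) * ((q ^ 2 - 1) / (q ^ 2 - 2 * q * Real.cos θ + 1)) := by
  have hs := Real.sin_pos_of_mem_Ioo hθ
  have hsc := Real.sin_sq_add_cos_sq θ
  have e : Real.sqrt (4 - (2 * Real.cos θ) ^ 2) = 2 * Real.sin θ := by
    rw [show 4 - (2 * Real.cos θ) ^ 2 = (2 * Real.sin θ) ^ 2 by linear_combination 4 * (-hsc)]
    exact Real.sqrt_sq (by linarith)
  have hq0 : 0 < q := by linarith
  have hc : Real.cos θ < 1 := by nlinarith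
  have hd : 0 < q ^ 2 - 2 * q * Real.cos θ + 1 := by nlinarith [sq_nonneg (q - 1)]
  have hz : q + q⁻¹ - 2 * Real.cos θ = (q ^ 2 - 2 * q * Real.cos θ + 1) / q := by
    field_simp
    ring
  rw [semicircleCauchy, e, abs_neg, abs_of_pos (by linarith), smul_eq_mul, hz]
  have h1 := hd.ne'
  generalize hD : q ^ 2 - 2 * q * Real.cos θ + 1 = D at *
  field_simp
  linear_combination (4 * q ^ 2) * hsc + (1 + q ^ 2 + 2 * q * Real.cos θ) * hD

theorem image_two_mul_cos_Ioo :
    (fun θ => 2 * Real.cos θ) '' Set.Ioo 0 Real.pi = Set.Ioo (-2 : ℝ) 2 := by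
  ext w
  constructor
  · rintro ⟨θ, hθ, rfl⟩
    have := Real.sin_pos_of_mem_Ioo hθ
    have := Real.sin_sq_add_cos_sq θ
    constructor <;> dsimp only <;> nlinarith
  · rintro ⟨h1, h2⟩
    refine ⟨Real.arccos (w / 2), ⟨Real.arccos_pos.2 (by linarith), ?_⟩, ?_⟩
    · refine lt_of_le_of_ne (Real.arccos_le_pi _) fun h => ?_
      rw [Real.arccos_eq_pi] at h
      linarith
    · dsimp only
      rw [Real.cos_arccos (by linarith) (by linarith)]
      ring

theorem semicircleCauchy_integral {q : ℝ} (hq : 1 ≤ q) :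
    Integrable (semicircleCauchy q) ∧ ∫ w, semicircleCauchy q w = 2 * Real.pi / q := by
  have hq0 : 0 < q := by linarith
  set g : ℝ → ℝ := fun θ => (q + q⁻¹ + 2 * Real.cos θ) -
        (q - q⁻¹) * ((q ^ 2 - 1) / (q ^ 2 - 2 * q * Real.cos θ + 1)) with hg
  have hP : IntervalIntegrable
      (fun θ => (q - q⁻¹) * ((q ^ 2 - 1) / (q ^ 2 - 2 * q * Real.cos θ + 1)))
      volume 0 Real.pi ∧
      ∫ θ in (0 : ℝ)..Real.pi, (q - q⁻¹) * ((q ^ 2 - 1) / (q ^ 2 - 2 * q * Real.cos θ + 1))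
        = (q - q⁻¹) * Real.pi := by
    rcases hq.eq_or_lt with rfl | h
    · simp
    · refine ⟨?_, by rw [intervalIntegral.integral_const_mul, integral_poissonKernel h]⟩
      apply Continuous.intervalIntegrable
      refine continuous_const.mul (continuous_const.div (by fun_prop) fun θ => ?_)
      nlinarith [Real.cos_le_one θ, pow_pos (sub_pos.2 h) 2]
  have hC : IntervalIntegrable (fun θ => q + q⁻¹ + 2 * Real.cos θ) volume 0 Real.pi :=
    Continuous.intervalIntegrable (by fun_prop) _ _
  have hgI : ∫ θ in (0 : ℝ)..Real.pi, g θ = 2 * Real.pi / q := by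
    rw [hg, intervalIntegral.integral_sub hC hP.1, hP.2, intervalIntegral.integral_add
      (by simp) (Continuous.intervalIntegrable (by fun_prop) _ _),
      intervalIntegral.integral_const_mul]
    simp
    field_simp
    ring
  have hgi : IntegrableOn g (Set.Ioo 0 Real.pi) :=
    (intervalIntegrable_iff_integrableOn_Ioo_of_le Real.pi_pos.le).1 (hC.sub hP.1)
  have hder : ∀ θ ∈ Set.Ioo 0 Real.pi,
      HasDerivWithinAt (fun θ => 2 * Real.cos θ) (-(2 * Real.sin θ)) (Set.Ioo 0 Real.pi) θ :=
    fun θ _ => (((Real.hasDerivAt_cos θ).const_mul 2).congr_deriv (by ring)).hasDerivWithinAt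
  have hinj : Set.InjOn (fun θ => 2 * Real.cos θ) (Set.Ioo 0 Real.pi) := by
    intro x hx y hy hxy
    exact Real.injOn_cos (Set.Ioo_subset_Icc_self hx) (Set.Ioo_subset_Icc_self hy)
      (by simpa using hxy)
  have hzero : ∀ w, w ∉ Set.Ioo (-2 : ℝ) 2 → semicircleCauchy q w = 0 := fun w hw => by
    rw [semicircleCauchy, sqrt_four_sub_sq_eq_zero hw, zero_div]
  constructor
  · rw [← integrableOn_iff_integrable_of_support_subset (s := Set.Ioo (-2 : ℝ) 2)
      (fun w hw => by_contra fun h => hw (hzero w h)), ← image_two_mul_cos_Ioo,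
      integrableOn_image_iff_integrableOn_abs_deriv_smul measurableSet_Ioo hder hinj]
    exact hgi.congr_fun (fun θ hθ => (semicircleCauchy_subst hq hθ).symm) measurableSet_Ioo
  · rw [← setIntegral_eq_integral_of_forall_compl_eq_zero hzero, ← image_two_mul_cos_Ioo,
      integral_image_eq_integral_abs_deriv_smul measurableSet_Ioo hder hinj,
      setIntegral_congr_fun measurableSet_Ioo (fun θ hθ => semicircleCauchy_subst hq hθ),
      ← hgI, intervalIntegral.integral_of_le Real.pi_pos.le, integral_Ioc_eq_integral_Ioo]

theorem one_le_sqrt_natCast {s : ℕ} (hs : 1 ≤ s) : 1 ≤ Real.sqrt s :=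
  Real.one_le_sqrt.2 (by exact_mod_cast hs)

theorem nuDensity_eq {s : ℕ} (hs : 1 ≤ s) (x : ℝ) :
    nuDensity s x = (2 * Real.pi * Real.sqrt s)⁻¹ *
      semicircleCauchy (Real.sqrt s) (-(x - Real.sqrt s)) := by
  have ht : 0 < Real.sqrt s := by linarith [one_le_sqrt_natCast hs]
  have e : x * Real.sqrt s + 1
      = Real.sqrt s * (Real.sqrt s + (Real.sqrt s)⁻¹ - -(x - Real.sqrt s)) := by
    field_simp
    ring
  rw [nuDensity, semicircleCauchy, e, neg_sq]
  rw [← mul_assoc, div_eq_mul_inv, mul_inv, div_eq_mul_inv]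
  ring

theorem nuDensity_eq_zero {s : ℕ} {x : ℝ} (hx : x - Real.sqrt s ∉ Set.Ioo (-2 : ℝ) 2) :
    nuDensity s x = 0 := by
  rw [nuDensity, sqrt_four_sub_sq_eq_zero hx, zero_div]

theorem nuDensity_nonneg {s : ℕ} (hs : 1 ≤ s) (x : ℝ) : 0 ≤ nuDensity s x := by
  by_cases hx : x - Real.sqrt s ∈ Set.Ioo (-2 : ℝ) 2
  · rw [nuDensity_eq hs, semicircleCauchy]
    have h := two_le_add_inv (one_le_sqrt_natCast hs)
    have : 0 ≤ Real.sqrt s + (Real.sqrt s)⁻¹ - -(x - Real.sqrt s) := by linarith [hx.1]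
    have := Real.pi_pos
    positivity
  · rw [nuDensity_eq_zero hx]

theorem nuDensity_ite (s : ℕ) (x : ℝ) :
    (if |x - Real.sqrt s| ≤ 2 then nuDensity s x else 0) = nuDensity s x := by
  split_ifs with h
  · rfl
  · exact (nuDensity_eq_zero fun h' => h (abs_le.2 ⟨h'.1.le, h'.2.le⟩)).symm

theorem nuMeas_eq (s : ℕ) : nuMeas s =
    volume.withDensity (fun x => ENNReal.ofReal (nuDensity s x))
      + ENNReal.ofReal (1 - 1 / (s : ℝ)) • Measure.dirac (-1 / Real.sqrt s) := by
  simp only [nuMeas, nuDensity_ite]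

theorem measurable_nuDensity (s : ℕ) : Measurable (nuDensity s) := by
  unfold nuDensity
  fun_prop

theorem measurable_fc (s : ℕ) (c : ℝ) : Measurable (fc s c) := by
  unfold fc
  fun_prop

theorem semicircleCauchy_comp_sub {q : ℝ} (hq : 1 ≤ q) (t : ℝ) :
    Integrable (fun x => semicircleCauchy q (x - t)) ∧
      ∫ x, semicircleCauchy q (x - t) = 2 * Real.pi / q := by
  obtain ⟨h1, h2⟩ := semicircleCauchy_integral hq
  exact ⟨h1.comp_sub_right t, by rw [integral_sub_right_eq_self (semicircleCauchy q), h2]⟩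

theorem semicircleCauchy_comp_neg_sub {q : ℝ} (hq : 1 ≤ q) (t : ℝ) :
    Integrable (fun x => semicircleCauchy q (-(x - t))) ∧
      ∫ x, semicircleCauchy q (-(x - t)) = 2 * Real.pi / q := by
  obtain ⟨h1, h2⟩ := semicircleCauchy_integral hq
  exact ⟨h1.comp_neg.comp_sub_right t, by
    rw [integral_sub_right_eq_self (fun x => semicircleCauchy q (-x)),
      integral_neg_eq_self (semicircleCauchy q), h2]⟩

theorem nuMeas_univ {s : ℕ} (hs : 1 ≤ s) : nuMeas s Set.univ = 1 := by
  have ht := one_le_sqrt_natCast hs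
  have hs1 : (1 : ℝ) ≤ s := by exact_mod_cast hs
  obtain ⟨h1, h2⟩ := semicircleCauchy_comp_neg_sub ht (Real.sqrt s)
  have hI : ∫⁻ x, ENNReal.ofReal (nuDensity s x) = ENNReal.ofReal (1 / s) := by
    rw [← ofReal_integral_eq_lintegral_ofReal _ (ae_of_all _ (nuDensity_nonneg hs))]
    · simp only [nuDensity_eq hs, integral_const_mul, h2]
      congr 1
      have := Real.pi_pos.ne'
      have := Real.sq_sqrt (by linarith : (0 : ℝ) ≤ s)
      field_simp
      linarith
    · simpa only [← nuDensity_eq hs] using h1.const_mul (2 * Real.pi * Real.sqrt s)⁻¹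
  have hle : (1 : ℝ) / s ≤ 1 := by rw [div_le_one (by linarith)]; exact hs1
  rw [nuMeas_eq]
  simp only [Measure.add_apply, Measure.smul_apply, withDensity_apply _ MeasurableSet.univ,
    Measure.restrict_univ, hI, measure_univ, smul_eq_mul, mul_one]
  rw [← ENNReal.ofReal_add (by positivity) (by linarith)]
  simp

theorem exp_eq_inv_exp_neg (c : ℝ) : Real.exp c = (Real.exp (-c))⁻¹ := by
  rw [Real.exp_neg, inv_inv]

theorem nuDensity_mul_fc {s : ℕ} (hs : 1 ≤ s) {c : ℝ} (hc : 1 ≤ Real.exp (-c)) (x : ℝ) :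
    nuDensity s x * fc s c x =
      (Real.exp c + Real.sqrt s) / (2 * Real.pi * Real.sqrt s *
        (Real.sqrt s + (Real.sqrt s)⁻¹ + (Real.exp (-c) + (Real.exp (-c))⁻¹))) *
      (semicircleCauchy (Real.sqrt s) (-(x - Real.sqrt s)) +
        semicircleCauchy (Real.exp (-c)) (x - Real.sqrt s)) := by
  have ht := one_le_sqrt_natCast hs
  rw [nuDensity_eq hs, fc, ← exp_eq_inv_exp_neg]
  simp only [semicircleCauchy, neg_sq, ← exp_eq_inv_exp_neg]
  have hT := two_le_add_inv ht
  have hz := two_le_add_inv hc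
  rw [← exp_eq_inv_exp_neg] at hz
  generalize Real.exp c = e at *
  generalize Real.exp (-c) = E at *
  by_cases hx : x - Real.sqrt s ∈ Set.Ioo (-2 : ℝ) 2
  · generalize Real.sqrt (4 - (x - Real.sqrt s) ^ 2) = S
    have h1 : Real.sqrt s + (Real.sqrt s)⁻¹ - -(x - Real.sqrt s) ≠ 0 := by linarith [hx.1]
    have h2 : E + e - (x - Real.sqrt s) ≠ 0 := by linarith [hx.2]
    have h3 : Real.sqrt s + (Real.sqrt s)⁻¹ + (E + e) ≠ 0 := by linarith
    have h4 : e + E + Real.sqrt s - x = E + e - (x - Real.sqrt s) := by ring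
    have h5 : Real.sqrt s ≠ 0 := by linarith
    rw [h4]
    generalize hi : (Real.sqrt s)⁻¹ = i at *
    have := Real.pi_pos.ne'
    field_simp
    ring
  · simp [sqrt_four_sub_sq_eq_zero hx]

theorem fc_nonneg {s : ℕ} {c x : ℝ} (hc : Real.sqrt s + 2 < Real.exp (-c))
    (hx : x ≤ Real.sqrt s + 2) : 0 ≤ fc s c x := by
  have := Real.exp_pos c
  have := Real.sqrt_nonneg s
  exact div_nonneg (by linarith) (by linarith)

theorem fc_le_one {s : ℕ} {c x : ℝ} (hc : Real.sqrt s + 2 < Real.exp (-c))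
    (hx : x ≤ Real.sqrt s + 2) : fc s c x ≤ 1 := by
  have := Real.exp_pos c
  have := Real.sqrt_nonneg s
  exact (div_le_one (by linarith)).2 (by linarith)

theorem nuMeas_ae_le (s : ℕ) : ∀ᵐ x ∂(nuMeas s), x ≤ Real.sqrt s + 2 := by
  rw [nuMeas_eq, ae_add_measure_iff]
  constructor
  · rw [ae_withDensity_iff (measurable_nuDensity s).ennreal_ofReal]
    refine ae_of_all _ fun x hx => ?_
    by_contra! h
    exact hx (by rw [nuDensity_eq_zero fun h' => by linarith [h'.2], ENNReal.ofReal_zero])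
  · refine Measure.ae_smul_measure ?_ _
    rw [ae_dirac_iff measurableSet_Iic]
    have := Real.sqrt_nonneg s
    have : -1 / Real.sqrt s ≤ 0 := div_nonpos_of_nonpos_of_nonneg (by norm_num) this
    linarith

theorem lintegral_fc_nuMeas {s : ℕ} (hs : 1 ≤ s) {c : ℝ}
    (hc : Real.sqrt s + 2 < Real.exp (-c)) :
    ∫⁻ x, ENNReal.ofReal (fc s c x) ∂(nuMeas s) =
      ENNReal.ofReal ((Real.exp c + Real.sqrt s) / (Real.exp (-c) + Real.sqrt s)) := by
  have ht := one_le_sqrt_natCast hs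
  have hs1 : (1 : ℝ) ≤ s := by exact_mod_cast hs
  have hE : 1 ≤ Real.exp (-c) := by linarith
  have he := Real.exp_pos c
  obtain ⟨h1, h2⟩ := semicircleCauchy_comp_neg_sub ht (Real.sqrt s)
  obtain ⟨h3, h4⟩ := semicircleCauchy_comp_sub hE (Real.sqrt s)
  have hat : -1 / Real.sqrt s ≤ Real.sqrt s + 2 := by
    have : -1 / Real.sqrt s ≤ 0 := div_nonpos_of_nonpos_of_nonneg (by norm_num) (by linarith)
    linarith
  have hle : (1 : ℝ) / s ≤ 1 := by rw [div_le_one (by linarith)]; exact hs1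
  have hnn (x : ℝ) : 0 ≤ nuDensity s x * fc s c x := by
    by_cases hx : x - Real.sqrt s ∈ Set.Ioo (-2 : ℝ) 2
    · exact mul_nonneg (nuDensity_nonneg hs x) (fc_nonneg hc (by linarith [hx.2]))
    · rw [nuDensity_eq_zero hx, zero_mul]
  rw [nuMeas_eq, lintegral_add_measure, lintegral_smul_measure,
    lintegral_dirac' _ (measurable_fc s c).ennreal_ofReal,
    lintegral_withDensity_eq_lintegral_mul _ (measurable_nuDensity s).ennreal_ofReal
      (measurable_fc s c).ennreal_ofReal]
  simp only [Pi.mul_apply, ← ENNReal.ofReal_mul (nuDensity_nonneg hs _), smul_eq_mul]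
  rw [← ENNReal.ofReal_mul (by linarith), ← ofReal_integral_eq_lintegral_ofReal _ (ae_of_all _ hnn),
    ← ENNReal.ofReal_add (integral_nonneg hnn)
      (mul_nonneg (by linarith) (fc_nonneg hc hat))]
  · congr 1
    simp only [nuDensity_mul_fc hs hE, integral_const_mul]
    rw [integral_add h1 h3, h2, h4, fc, exp_eq_inv_exp_neg c]
    have hss := Real.sq_sqrt (by linarith : (0 : ℝ) ≤ s)
    rw [← hss, Real.sqrt_sq (by linarith)]
    generalize Real.exp (-c) = E at *
    generalize Real.sqrt s = t at *
    have hpi := Real.pi_pos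
    have hE0 : 0 < E := by linarith
    have ht0 : 0 < t := by linarith
    have k1 : t + t⁻¹ + (E + E⁻¹) = (t + E) * (1 + t * E) / (t * E) := by
      field_simp
      ring
    have k2 : E⁻¹ + E + t - -1 / t = (t + E) * (1 + t * E) / (t * E) := by
      field_simp
      ring
    rw [k1, k2]
    field_simp
    ring
  · simpa only [Pi.add_apply, ← nuDensity_mul_fc hs hE] using (h1.add h3).const_mul ((Real.exp c + Real.sqrt s) /
      (2 * Real.pi * Real.sqrt s *
        (Real.sqrt s + (Real.sqrt s)⁻¹ + (Real.exp (-c) + (Real.exp (-c))⁻¹))))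

/-- If `μ ≤ ν`, then adding to `μ` an atom of mass `ν(ℝ) - μ(ℝ)` at a `ν`-null point gives a
measure whose total variation distance to `ν` is the mass of the atom. -/
theorem dTV_add_smul_dirac {μ ν : Measure ℝ} [IsFiniteMeasure ν] (hle : μ ≤ ν) {m y : ℝ}
    (hm : 0 ≤ m) (hy : ν {y} = 0) (hmass : ν.real Set.univ = μ.real Set.univ + m) :
    dTV (μ + ENNReal.ofReal m • Measure.dirac y) ν = m := by
  have : IsFiniteMeasure μ := isFiniteMeasure_of_le ν hle
  have hmono (A : Set ℝ) : μ.real A ≤ ν.real A :=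
    ENNReal.toReal_mono (measure_ne_top ν A) (hle A)
  have hval (A : Set ℝ) (hA : MeasurableSet A) :
      ((μ + ENNReal.ofReal m • Measure.dirac y) A).toReal
        = μ.real A + m * A.indicator 1 y := by
    rw [Measure.add_apply, Measure.smul_apply, Measure.dirac_apply' _ hA, smul_eq_mul,
      ENNReal.toReal_add (measure_ne_top μ A)
        (ENNReal.mul_ne_top ENNReal.ofReal_ne_top (by by_cases h : y ∈ A <;> simp [h])),
      ENNReal.toReal_mul, ENNReal.toReal_ofReal hm]
    by_cases h : y ∈ A <;> simp [h, Measure.real]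
  have hbound (A : {A : Set ℝ // MeasurableSet A}) :
      |((μ + ENNReal.ofReal m • Measure.dirac y) A.1).toReal - (ν A.1).toReal| ≤ m := by
    obtain ⟨A, hA⟩ := A
    have h1 := hmono A
    have h2 := hmono Aᶜ
    have h3 := measureReal_add_measureReal_compl (μ := μ) hA
    have h4 := measureReal_add_measureReal_compl (μ := ν) hA
    have h5 : 0 ≤ m * A.indicator (1 : ℝ → ℝ) y ∧ m * A.indicator (1 : ℝ → ℝ) y ≤ m := by
      by_cases h : y ∈ A <;> simp [h, hm]
    dsimp only
    rw [hval A hA, ← measureReal_def, abs_le]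
    constructor <;> linarith
  unfold dTV
  have : Nonempty {A : Set ℝ // MeasurableSet A} := ⟨⟨∅, MeasurableSet.empty⟩⟩
  refine le_antisymm (ciSup_le hbound) ?_
  refine le_trans ?_ (le_ciSup ⟨m, Set.forall_mem_range.2 hbound⟩
    ⟨{y}, measurableSet_singleton y⟩)
  dsimp only
  have hμ : μ.real {y} = 0 := le_antisymm
    ((hmono {y}).trans_eq (by rw [measureReal_def, hy, ENNReal.toReal_zero])) measureReal_nonneg
  rw [hval _ (measurableSet_singleton y), hμ, hy]
  simp [le_abs_self]

theorem dTV_etaMeas {s : ℕ} (hs : 1 ≤ s) {c : ℝ} (hc : Real.sqrt s + 2 < Real.exp (-c)) :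
    dTV (etaMeas s c) (nuMeas s) =
      (Real.exp (-c) - Real.exp c) / (Real.exp (-c) + Real.sqrt s) := by
  have ht := one_le_sqrt_natCast hs
  have he := Real.exp_pos c
  have hc0 : c < 0 := by
    have : 0 < -c := Real.one_lt_exp_iff.1 (by linarith)
    linarith
  have : IsFiniteMeasure (nuMeas s) := ⟨by rw [nuMeas_univ hs]; exact ENNReal.one_lt_top⟩
  rw [etaMeas, if_pos hc0]
  refine dTV_add_smul_dirac ?_ ?_ ?_ ?_
  · calc (nuMeas s).withDensity (fun x => ENNReal.ofReal (fc s c x))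
        ≤ (nuMeas s).withDensity 1 := by
          refine withDensity_mono ?_
          filter_upwards [nuMeas_ae_le s] with x hx
          exact ENNReal.ofReal_le_one.2 (fc_le_one hc hx)
      _ = nuMeas s := withDensity_one
  · have : Real.exp c < Real.exp (-c) := Real.exp_lt_exp.2 (by linarith)
    exact div_nonneg (by linarith) (by linarith)
  · refine measure_mono_null ?_ (ae_iff.1 (nuMeas_ae_le s))
    rintro _ rfl
    simp only [Set.mem_ofPred_eq, not_le]
    linarith
  · rw [measureReal_def, measureReal_def, nuMeas_univ hs,
      withDensity_apply _ MeasurableSet.univ, Measure.restrict_univ, lintegral_fc_nuMeas hs hc,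
      ENNReal.toReal_ofReal (by positivity), ENNReal.toReal_one]
    have : Real.exp (-c) + Real.sqrt s ≠ 0 := by linarith
    field_simp
    ring

theorem dTV_etaMeas_shift {s : ℕ} (hs : 1 ≤ s) {c : ℝ}
    (hc : Real.exp c < Real.sqrt s / (Real.sqrt s + 2)) :
    dTV (etaMeas s (c - Real.log (Real.sqrt s))) (nuMeas s) =
      1 - Real.exp c * ((1 + Real.exp c / s) / (1 + Real.exp c)) := by
  have ht := one_le_sqrt_natCast hs
  have ht0 : 0 < Real.sqrt s := by linarith
  have he := Real.exp_pos c
  have h1 : Real.exp (-(c - Real.log (Real.sqrt s))) = Real.sqrt s / Real.exp c := by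
    rw [neg_sub, Real.exp_sub, Real.exp_log ht0]
  rw [dTV_etaMeas hs, h1, Real.exp_sub, Real.exp_log ht0]
  · have hss := Real.sq_sqrt (Nat.cast_nonneg s : (0 : ℝ) ≤ s)
    rw [← hss, Real.sqrt_sq ht0.le]
    field_simp
    ring
  · rw [h1, lt_div_iff₀ he]
    rw [lt_div_iff₀ (by linarith)] at hc
    linarith

theorem tendsto_log_profile (s : ℕ) {l : Filter ℝ} {g : ℝ → ℝ} (hg : Tendsto g l atBot) :
    Tendsto (fun c => Real.log ((1 + Real.exp (g c) / s) / (1 + Real.exp (g c)))) l (nhds 0) := by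
  have h := Real.tendsto_exp_atBot.comp hg
  have h1 : Tendsto (fun c => (1 + Real.exp (g c) / s) / (1 + Real.exp (g c))) l (nhds 1) := by
    have := ((h.div_const (s : ℝ)).const_add 1).div (h.const_add 1) (by norm_num)
    simp only [zero_div, add_zero, div_one] at this
    exact this
  simpa using h1.log one_ne_zero

theorem eq_zero_of_tendsto_affine_atBot {k b : ℝ}
    (h : Tendsto (fun c => k * c + b) atBot (nhds 0)) : k = 0 ∧ b = 0 := by
  have h1 := h.comp (tendsto_atBot_add_const_right atBot (-1 : ℝ) tendsto_id)
  have h2 : Tendsto (fun _ : ℝ => k) atBot (nhds 0) := by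
    rw [← sub_zero (0 : ℝ)]
    refine (h.sub h1).congr fun c => ?_
    simp only [Function.comp, id]
    ring
  have hk : k = 0 := tendsto_nhds_unique tendsto_const_nhds h2
  subst hk
  simp only [zero_mul, zero_add] at h
  exact ⟨rfl, tendsto_nhds_unique tendsto_const_nhds h⟩

/-- Each `s` defines a distinct cutoff profile `F_s(c) = d_TV(η^s_{c - ln √s}, ν_s)`
up to affine transformation. -/
theorem stmt12 (r s : ℕ) (hr : 1 ≤ r) (hs : 1 ≤ s) (a b : ℝ) (ha : 0 < a)
    (h : ∀ c : ℝ,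
      dTV (etaMeas r (a * c + b - Real.log (Real.sqrt r))) (nuMeas r) =
      dTV (etaMeas s (c - Real.log (Real.sqrt s))) (nuMeas s)) :
    a = 1 ∧ b = 0 ∧ r = s := by
  have hlin : Tendsto (fun c => a * c + b) atBot atBot :=
    tendsto_atBot_add_const_right _ _ (tendsto_id.const_mul_atBot ha)
  have hsmall {q : ℕ} (hq : 1 ≤ q) {g : ℝ → ℝ} (hg : Tendsto g atBot atBot) :
      ∀ᶠ c in atBot, Real.exp (g c) < Real.sqrt q / (Real.sqrt q + 2) := by
    have := one_le_sqrt_natCast hq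
    exact (Real.tendsto_exp_atBot.comp hg).eventually_lt_const (by positivity)
  have key : ∀ᶠ c in atBot,
      Real.exp (a * c + b) * ((1 + Real.exp (a * c + b) / r) / (1 + Real.exp (a * c + b))) =
        Real.exp c * ((1 + Real.exp c / s) / (1 + Real.exp c)) := by
    filter_upwards [hsmall hr hlin, hsmall (g := fun c => c) hs tendsto_id] with c h1 h2
    have := h c
    rw [dTV_etaMeas_shift hr h1, dTV_etaMeas_shift hs h2] at this
    linarith
  have hlim : Tendsto (fun c => (a - 1) * c + b) atBot (nhds 0) := by
    have := (tendsto_log_profile s tendsto_id).sub (tendsto_log_profile r hlin)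
    rw [sub_zero] at this
    refine this.congr' ?_
    filter_upwards [key] with c hc
    have := congrArg Real.log hc
    rw [Real.log_mul (by positivity) (by positivity), Real.log_mul (by positivity) (by positivity),
      Real.log_exp, Real.log_exp] at this
    simp only [id]
    linarith
  obtain ⟨ha1, rfl⟩ := eq_zero_of_tendsto_affine_atBot hlim
  obtain rfl : a = 1 := by linarith
  obtain ⟨c, hc⟩ := key.exists
  refine ⟨rfl, rfl, ?_⟩
  have he := Real.exp_pos c
  rw [one_mul, add_zero, mul_right_inj' he.ne', div_left_inj' (by positivity), add_right_inj,
    div_eq_mul_inv, div_eq_mul_inv, mul_right_inj' he.ne', inv_inj] at hc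
  exact_mod_cast hc
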